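/- Fix 0 < q < 1 and integers N ≥ 2, 1 ≤ n ≤ N-1. For α > q^{1-N}, the quantum q-Krawtchouk polynomial K̃_n^{(α)}(·;q) has n distinct real zeros x_1(α) < ⋯ < x_n(α), and for each j ∈ {1,...,n} the zero x_j(α) is a strictly decreasing function of α on (q^{1-N}, ∞). -/

import Mathlib

/-- q-Pochhammer symbol `(a;q)_k = ∏_{j=0}^{k-1} (1 - a q^j)`. -/
noncomputable def qpoch (q a : ℝ) (k : ℕ) : ℝ := ∏ j ∈ Finset.range k, (1 - a * q ^ j)

/-- Quantum q-Krawtchouk polynomial `K̃_n^{(α)}(x;q)`. -/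
noncomputable def quantumQKrawtchoukPoly (q : ℝ) (N n : ℕ) (α x : ℝ) : ℝ :=
  (qpoch q (q ^ (-(N : ℤ))) n / (α ^ n * q ^ (n ^ 2))) *
    ∑ k ∈ Finset.range (n + 1),
      qpoch q (q ^ (-(n : ℤ))) k * qpoch q x k /
        (qpoch q (q ^ ((1 : ℤ) - (N : ℤ))) k * qpoch q q k) * (α * q ^ (n + 1)) ^ k

open Polynomial Finset in
/-- The linear functional `p ↦ ∑_{x ≤ M} w x * p (t x)` attached to weights on finitely many nodes. -/
noncomputable def discreteIntegral (M : ℕ) (t w : ℕ → ℝ) : ℝ[X] →ₗ[ℝ] ℝ :=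
  ∑ x ∈ range (M + 1), w x • Polynomial.leval (t x)

section DiscreteOrthogonality

open Polynomial Finset

variable {M : ℕ} {t w : ℕ → ℝ}

lemma discreteIntegral_apply (p : ℝ[X]) :
    discreteIntegral M t w p = ∑ x ∈ range (M + 1), w x * p.eval (t x) := by
  simp [discreteIntegral, leval_apply]

lemma exists_eval_ne_zero_of_natDegree_lt_card (ht : StrictMono t) {f : ℝ[X]} (hf : f ≠ 0)
    (S : Finset ℕ) (hS : f.natDegree < #S) : ∃ x ∈ S, f.eval (t x) ≠ 0 := by
  by_contra! h
  refine hf (eq_zero_of_natDegree_lt_card_of_eval_eq_zero' f (S.image t) ?_ ?_)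
  · simpa using h
  · rwa [card_image_of_injective _ ht.injective]

/-- An orthogonal polynomial has no nonconstant factor that is nonnegative on the nodes. -/
lemma not_nonneg_factor_of_orthogonal (ht : StrictMono t) (hw : ∀ x ≤ M, 0 < w x) {P A B : ℝ[X]}
    (hP : P ≠ 0) (hPM : P.natDegree ≤ M)
    (horth : ∀ g : ℝ[X], g.natDegree < P.natDegree → discreteIntegral M t w (P * g) = 0)
    (hPAB : P = B * A) (hB : ∀ y, 0 ≤ B.eval y) : B.natDegree = 0 := by
  by_contra hB0
  have hA : A ≠ 0 := by rintro rfl; simp [hPAB] at hP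
  have hB' : B ≠ 0 := by rintro rfl; simp [hPAB] at hP
  have hdeg : A.natDegree < P.natDegree := by
    rw [hPAB, natDegree_mul hB' hA]; omega
  obtain ⟨x, hx, hPx⟩ := exists_eval_ne_zero_of_natDegree_lt_card ht hP (range (M + 1))
    (by simpa [Nat.lt_succ_iff] using hPM)
  have h0 := horth A hdeg
  rw [discreteIntegral_apply] at h0
  have hnn : ∀ y ∈ range (M + 1), 0 ≤ w y * (P * A).eval (t y) := by
    intro y hy
    have := hw y (by simpa [Nat.lt_succ_iff] using hy)
    have hev : (P * A).eval (t y) = B.eval (t y) * (A.eval (t y)) ^ 2 := by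
      rw [hPAB]; simp; ring
    rw [hev]
    exact mul_nonneg this.le (mul_nonneg (hB _) (sq_nonneg _))
  have h1 := (sum_eq_zero_iff_of_nonneg hnn).1 h0 x hx
  have hwx := hw x (by simpa [Nat.lt_succ_iff] using hx)
  rw [eval_mul] at h1
  rcases mul_eq_zero.1 h1 with h | h
  · exact hwx.ne' h
  rcases mul_eq_zero.1 h with h | h
  · exact hPx h
  · exact hPx (by rw [hPAB, eval_mul, h, mul_zero])

lemma splits_of_orthogonal (ht : StrictMono t) (hw : ∀ x ≤ M, 0 < w x) {P : ℝ[X]}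
    (hP : P ≠ 0) (hPM : P.natDegree ≤ M)
    (horth : ∀ g : ℝ[X], g.natDegree < P.natDegree → discreteIntegral M t w (P * g) = 0) :
    P.Splits := by
  obtain ⟨u, hu⟩ := UniqueFactorizationMonoid.factors_prod hP
  rw [← hu]
  refine (Splits.multisetProd fun g hgf => Splits.of_degree_eq_one ?_).mul u.isUnit.splits
  have hg := UniqueFactorizationMonoid.irreducible_of_factor g hgf
  have hgP := UniqueFactorizationMonoid.dvd_of_mem_factors hgf
  have hgd : g.degree ≠ 0 := hg.degree_pos.ne'
  obtain ⟨z, hz⟩ := IsAlgClosed.exists_aeval_eq_zero ℂ g hgd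
  by_cases him : z.im = 0
  · refine degree_eq_one_of_irreducible_of_root (x := z.re) hg ?_
    have hz' : z = (z.re : ℂ) := Complex.ext rfl (by simpa using him)
    rw [hz', ← Complex.coe_algebraMap, aeval_algebraMap_apply] at hz
    simpa using hz
  · exfalso
    obtain ⟨A, hA⟩ := (quadratic_dvd_of_aeval_eq_zero_im_ne_zero g hz him).trans hgP
    have := not_nonneg_factor_of_orthogonal ht hw hP hPM horth hA (fun y => by
      have : ‖z‖ ^ 2 = z.re ^ 2 + z.im ^ 2 := by
        rw [Complex.sq_norm, Complex.normSq_apply]; ring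
      simp only [eval_add, eval_sub, eval_mul, eval_pow, eval_X, eval_C, this]
      nlinarith [sq_nonneg (y - z.re), sq_nonneg z.im])
    have hd : (X ^ 2 - C (2 * z.re) * X + C (‖z‖ ^ 2)).natDegree = 2 := by compute_degree!
    omega

lemma nodup_roots_of_orthogonal (ht : StrictMono t) (hw : ∀ x ≤ M, 0 < w x) {P : ℝ[X]}
    (hP : P ≠ 0) (hPM : P.natDegree ≤ M)
    (horth : ∀ g : ℝ[X], g.natDegree < P.natDegree → discreteIntegral M t w (P * g) = 0) :
    P.roots.Nodup := by
  rw [Multiset.nodup_iff_count_le_one]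
  intro a
  rw [count_roots]
  by_contra! h
  obtain ⟨A, hA⟩ := (pow_dvd_pow (X - C a) (show 2 ≤ P.rootMultiplicity a from h)).trans
    (P.pow_rootMultiplicity_dvd a)
  have := not_nonneg_factor_of_orthogonal ht hw hP hPM horth hA
    (fun y => by simpa using sq_nonneg (y - a))
  simp [natDegree_pow] at this

/-- The zeros of an orthogonal polynomial are real and simple; they are listed increasingly. -/
lemma exists_strictMono_zeros_of_orthogonal (ht : StrictMono t) (hw : ∀ x ≤ M, 0 < w x) {P : ℝ[X]}
    {n : ℕ} (hP : P ≠ 0) (hn : P.natDegree = n) (hnM : n ≤ M)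
    (horth : ∀ g : ℝ[X], g.natDegree < n → discreteIntegral M t w (P * g) = 0) :
    ∃ x : Fin n → ℝ, StrictMono x ∧ ∀ y, P.eval y = 0 ↔ ∃ j, y = x j := by
  subst hn
  have hcard : P.roots.toFinset.card = P.natDegree := by
    rw [Multiset.toFinset_card_of_nodup (nodup_roots_of_orthogonal ht hw hP hnM horth)]
    exact (splits_of_orthogonal ht hw hP hnM horth).natDegree_eq_card_roots.symm
  refine ⟨P.roots.toFinset.orderEmbOfFin hcard, OrderEmbedding.strictMono _, fun y => ?_⟩
  have hr : y ∈ Set.range (P.roots.toFinset.orderEmbOfFin hcard) ↔ P.eval y = 0 := by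
    rw [range_orderEmbOfFin]
    simp [hP]
  rw [← hr, Set.mem_range]
  exact exists_congr fun j => eq_comm

/-- Gauss quadrature for the zeros of an orthogonal polynomial. -/
lemma exists_gauss_quadrature (hw : ∀ x ≤ M, 0 < w x) {P : ℝ[X]} {n : ℕ}
    (hP : P ≠ 0) (hn : P.natDegree = n)
    (horth : ∀ g : ℝ[X], g.natDegree < n → discreteIntegral M t w (P * g) = 0)
    {x : Fin n → ℝ} (hx : StrictMono x) (hx0 : ∀ j, P.eval (x j) = 0) :
    ∃ l : Fin n → ℝ, (∀ j, 0 ≤ l j) ∧ ∀ h : ℝ[X], h.natDegree < 2 * n →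
      discreteIntegral M t w h = ∑ j, h.eval (x j) * l j := by
  have hinj : Set.InjOn x (univ : Finset (Fin n)) := hx.injective.injOn
  have key : ∀ h : ℝ[X], h.natDegree < 2 * n → discreteIntegral M t w h =
      ∑ j, h.eval (x j) * discreteIntegral M t w (Lagrange.basis univ x j) := by
    intro h hh
    have hmod : h % P = Lagrange.interpolate univ x fun j => h.eval (x j) := by
      refine Lagrange.eq_interpolate_of_eval_eq _ hinj ?_ fun i _ => ?_
      · simpa [hn, degree_eq_natDegree hP] using degree_mod_lt h hP
      · rw [EuclideanDomain.mod_eq_sub_mul_div, eval_sub, eval_mul, hx0, zero_mul, sub_zero]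
    have hdiv : (h / P).natDegree < n := by
      rw [Polynomial.div_def, natDegree_C_mul (inv_ne_zero (leadingCoeff_ne_zero.2 hP)),
        natDegree_divByMonic _ (monic_mul_leadingCoeff_inv hP), natDegree_mul_leadingCoeff_inv _ hP]
      omega
    conv_lhs => rw [← EuclideanDomain.div_add_mod h P, map_add, horth _ hdiv, zero_add, hmod,
      Lagrange.interpolate_apply, map_sum]
    refine sum_congr rfl fun j _ => ?_
    rw [← smul_eq_C_mul, map_smul, smul_eq_mul]
  refine ⟨_, fun j => ?_, key⟩
  have hsq := key (Lagrange.basis univ x j ^ 2) (by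
    have hd := Lagrange.natDegree_basis hinj (mem_univ j)
    have := j.pos
    rw [natDegree_pow, hd, card_univ, Fintype.card_fin]
    omega)
  rw [sum_eq_single j, eval_pow, Lagrange.eval_basis_self hinj (mem_univ j), one_pow, one_mul] at hsq
  · rw [← hsq, discreteIntegral_apply]
    refine sum_nonneg fun y hy => mul_nonneg (hw y (by simpa [Nat.lt_succ_iff] using hy)).le ?_
    rw [eval_pow]
    exact sq_nonneg _
  · intro i _ hij
    rw [eval_pow, Lagrange.eval_basis_of_ne hij.symm (mem_univ i)]
    simp
  · simp

/-- A nonlocal form of Markov's theorem: if the ratio `w / w'` of two weights is increasing,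
then the zeros for `w'` lie strictly to the left of the zeros for `w`. -/
lemma zeros_lt_of_weight_ratio_strictMono {w' : ℕ → ℝ} (ht : StrictMono t)
    (hw : ∀ x ≤ M, 0 < w x) (hw' : ∀ x ≤ M, 0 < w' x)
    (hratio : ∀ x y, x < y → y ≤ M → w x / w' x < w y / w' y)
    {P P' : ℝ[X]} {n : ℕ} (hnM : n ≤ M)
    (hP : P ≠ 0) (hPn : P.natDegree = n) (hP' : P' ≠ 0) (hPn' : P'.natDegree = n)
    (horth : ∀ g : ℝ[X], g.natDegree < n → discreteIntegral M t w (P * g) = 0)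
    (horth' : ∀ g : ℝ[X], g.natDegree < n → discreteIntegral M t w' (P' * g) = 0)
    {x x' : Fin n → ℝ} (hx : StrictMono x) (hx' : StrictMono x')
    (hx0 : ∀ j, P.eval (x j) = 0) (hx0' : ∀ j, P'.eval (x' j) = 0) (k : Fin n) :
    x' k < x k := by
  obtain ⟨l, hl, hquad⟩ := exists_gauss_quadrature hw hP hPn horth hx hx0
  obtain ⟨l', hl', hquad'⟩ := exists_gauss_quadrature hw' hP' hPn' horth' hx' hx0'
  have hnpos := k.pos
  set f : ℝ[X] := ∏ i ∈ univ.erase k, (X - C (if i < k then x' i else x i)) with hf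
  have hfmonic : f.Monic := monic_prod_of_monic _ _ fun i _ => monic_X_sub_C _
  have hfdeg : f.natDegree = n - 1 := by
    rw [hf, natDegree_prod_of_monic _ _ fun i _ => monic_X_sub_C _]
    simp
  have hfeval : ∀ i, i ≠ k → f.eval (if i < k then x' i else x i) = 0 := by
    intro i hi
    rw [hf, eval_prod]
    exact prod_eq_zero (mem_erase.2 ⟨hi, mem_univ i⟩) (by simp)
  have hhdeg : ∀ s, ((X - C s) * f ^ 2).natDegree < 2 * n := by
    intro s
    rw [natDegree_mul (X_sub_C_ne_zero s) (pow_ne_zero 2 hfmonic.ne_zero), natDegree_pow, hfdeg,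
      natDegree_X_sub_C]
    omega
  have hle : discreteIntegral M t w ((X - C (x k)) * f ^ 2) ≤ 0 := by
    rw [hquad _ (hhdeg _)]
    refine sum_nonpos fun i _ => mul_nonpos_of_nonpos_of_nonneg ?_ (hl i)
    rcases lt_trichotomy i k with hik | rfl | hik
    · simp only [eval_mul, eval_sub, eval_X, eval_C, eval_pow]
      exact mul_nonpos_of_nonpos_of_nonneg (by linarith [hx hik]) (sq_nonneg _)
    · simp
    · have := hfeval i hik.ne'
      rw [if_neg hik.not_gt] at this
      simp [this]
  have hge : 0 ≤ discreteIntegral M t w' ((X - C (x' k)) * f ^ 2) := by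
    rw [hquad' _ (hhdeg _)]
    refine sum_nonneg fun i _ => mul_nonneg ?_ (hl' i)
    rcases lt_trichotomy i k with hik | rfl | hik
    · have := hfeval i hik.ne
      rw [if_pos hik] at this
      simp [this]
    · simp
    · simp only [eval_mul, eval_sub, eval_X, eval_C, eval_pow]
      exact mul_nonneg (by linarith [hx' hik]) (sq_nonneg _)
  classical
  set m := Nat.findGreatest (fun y => t y ≤ x' k) M with hm
  have hmM : m ≤ M := Nat.findGreatest_le M
  set c := w m / w' m with hc
  have hcpos : 0 < c := div_pos (hw m hmM) (hw' m hmM)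
  have hsign : ∀ y ≤ M, y ≠ m → 0 < (t y - x' k) * (w y - c * w' y) := by
    intro y hy hym
    have hw'y := hw' y hy
    have hfac : w y - c * w' y = (w y / w' y - c) * w' y := by field_simp
    rw [hfac, ← mul_assoc]
    refine mul_pos ?_ hw'y
    rcases lt_or_gt_of_ne hym with h | h
    · have h1 : t m ≤ x' k := Nat.findGreatest_of_ne_zero (P := fun y => t y ≤ x' k) hm.symm (by omega)
      exact mul_pos_of_neg_of_neg (by linarith [ht h]) (by linarith [hratio y m h hmM])
    · have h1 : ¬ t y ≤ x' k := Nat.findGreatest_is_greatest (P := fun y => t y ≤ x' k) h hy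
      exact mul_pos (by linarith [not_le.1 h1]) (by linarith [hratio m y h hy])
  have hzero : w m - c * w' m = 0 := by
    have := (hw' m hmM).ne'
    rw [hc]; field_simp; ring
  have hstrict : 0 < discreteIntegral M t w ((X - C (x' k)) * f ^ 2) -
      c * discreteIntegral M t w' ((X - C (x' k)) * f ^ 2) := by
    rw [discreteIntegral_apply, discreteIntegral_apply, mul_sum, ← sum_sub_distrib]
    have hterm : ∀ y, w y * ((X - C (x' k)) * f ^ 2).eval (t y) -
        c * (w' y * ((X - C (x' k)) * f ^ 2).eval (t y)) =
        (t y - x' k) * (w y - c * w' y) * (f.eval (t y)) ^ 2 := by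
      intro y; simp; ring
    simp_rw [hterm]
    have hnn : ∀ y ∈ range (M + 1), 0 ≤ (t y - x' k) * (w y - c * w' y) * (f.eval (t y)) ^ 2 := by
      intro y hy
      by_cases hym : y = m
      · simp [hym, hzero]
      · exact mul_nonneg (hsign y (by simpa [Nat.lt_succ_iff] using hy) hym).le (sq_nonneg _)
    obtain ⟨y, hy, hfy⟩ := exists_eval_ne_zero_of_natDegree_lt_card ht hfmonic.ne_zero
      ((range (M + 1)).erase m) (by
        rw [card_erase_of_mem (by simp; omega), hfdeg, card_range]; omega)
    rw [mem_erase, mem_range] at hy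
    exact sum_pos' hnn ⟨y, by simpa using hy.2,
      mul_pos (hsign y (by omega) hy.1) (by positivity)⟩
  have hwpos : 0 ≤ discreteIntegral M t w (f ^ 2) := by
    rw [discreteIntegral_apply]
    refine sum_nonneg fun y hy => mul_nonneg (hw y (by simpa [Nat.lt_succ_iff] using hy)).le ?_
    rw [eval_pow]
    exact sq_nonneg _
  have hdiff : discreteIntegral M t w ((X - C (x' k)) * f ^ 2) =
      discreteIntegral M t w ((X - C (x k)) * f ^ 2) +
        (x k - x' k) * discreteIntegral M t w (f ^ 2) := by
    rw [← smul_eq_mul (x k - x' k), ← map_smul, ← map_add, smul_eq_C_mul, C_sub]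
    congr 1
    ring
  have := mul_nonneg hcpos.le hge
  by_contra! hcon
  have := mul_nonneg (sub_nonneg.2 hcon) hwpos
  linarith

end DiscreteOrthogonality

section QPochhammer

open Finset

lemma qpoch_zero (q a : ℝ) : qpoch q a 0 = 1 := by simp [qpoch]

lemma qpoch_succ (q a : ℝ) (k : ℕ) : qpoch q a (k + 1) = qpoch q a k * (1 - a * q ^ k) := by
  simp [qpoch, prod_range_succ]

lemma qpoch_add (q a : ℝ) (i j : ℕ) :
    qpoch q a (i + j) = qpoch q a i * qpoch q (a * q ^ i) j := by
  simp only [qpoch, prod_range_add, pow_add, mul_assoc]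

lemma qpoch_succ' (q a : ℝ) (k : ℕ) : qpoch q a (k + 1) = (1 - a) * qpoch q (a * q) k := by
  rw [add_comm, qpoch_add]
  simp [qpoch]

lemma qpoch_self_pos {q : ℝ} (hq0 : 0 < q) (hq1 : q < 1) (k : ℕ) : 0 < qpoch q q k := by
  refine prod_pos fun j _ => ?_
  have : q ^ (j + 1) < 1 := pow_lt_one₀ hq0.le hq1 (by omega)
  rw [pow_succ'] at this
  linarith

lemma qpoch_inv_pow_eq_zero {q : ℝ} (hq : q ≠ 0) {x k : ℕ} (h : x < k) :
    qpoch q (q⁻¹ ^ x) k = 0 := by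
  refine prod_eq_zero (mem_range.2 h) ?_
  rw [← mul_pow, inv_mul_cancel₀ hq, one_pow, sub_self]

/-- `(q^{-(k+y)};q)_k` in terms of the `(q;q)` symbols. -/
lemma qpoch_inv_pow_mul {q : ℝ} (hq : q ≠ 0) (k y : ℕ) :
    qpoch q (q⁻¹ ^ (k + y)) k * qpoch q q y =
      (-1) ^ k * q ^ (k.choose 2) * q⁻¹ ^ ((k + y) * k) * qpoch q q (k + y) := by
  induction k generalizing y with
  | zero => simp [qpoch_zero]
  | succ k ih =>
    have h := ih (y + 1)
    rw [qpoch_succ] at h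
    rw [qpoch_succ, Nat.choose_succ_succ' k 1, Nat.choose_one_right, show k + 1 + y = k + (y + 1) by ring]
    have e1 : q⁻¹ ^ (k + (y + 1)) * q ^ k = q⁻¹ ^ (y + 1) := by
      rw [pow_add, mul_right_comm, ← mul_pow, inv_mul_cancel₀ hq, one_pow, one_mul]
    have e2 : (1 - q⁻¹ ^ (y + 1)) = - q⁻¹ ^ (y + 1) * (1 - q * q ^ y) := by
      rw [← pow_succ']
      have : q⁻¹ ^ (y + 1) * q ^ (y + 1) = 1 := by rw [← mul_pow, inv_mul_cancel₀ hq, one_pow]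
      linear_combination -this
    rw [e1, e2, show (k + (y + 1)) * (k + 1) = (k + (y + 1)) * k + (k + (y + 1)) by ring,
      pow_add q⁻¹ ((k + (y + 1)) * k),
      pow_add q k, pow_succ (-1 : ℝ)]
    linear_combination (-q⁻¹ ^ (y + 1)) * h + ((-1) ^ k * q ^ (k.choose 2) *
      q⁻¹ ^ ((k + (y + 1)) * k) * qpoch q q (k + (y + 1))) * e1

/-- Summation form of the `q`-Pascal rule. -/
lemma sum_antidiagonal_qpascal {q : ℝ} (hq0 : 0 < q) (hq1 : q < 1) (L : ℕ) (F : ℕ → ℕ → ℝ) :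
    (1 - q * q ^ L) * ∑ p ∈ antidiagonal (L + 1),
        F p.1 p.2 / (qpoch q q p.1 * qpoch q q p.2) =
      ∑ p ∈ antidiagonal L, q ^ p.1 * F p.1 (p.2 + 1) / (qpoch q q p.1 * qpoch q q p.2) +
      ∑ p ∈ antidiagonal L, F (p.1 + 1) p.2 / (qpoch q q p.1 * qpoch q q p.2) := by
  have hsplit : (1 - q * q ^ L) * ∑ p ∈ antidiagonal (L + 1),
        F p.1 p.2 / (qpoch q q p.1 * qpoch q q p.2) =
      ∑ p ∈ antidiagonal (L + 1),
        q ^ p.1 * (1 - q ^ p.2) * (F p.1 p.2 / (qpoch q q p.1 * qpoch q q p.2)) +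
      ∑ p ∈ antidiagonal (L + 1),
        (1 - q ^ p.1) * (F p.1 p.2 / (qpoch q q p.1 * qpoch q q p.2)) := by
    rw [mul_sum, ← sum_add_distrib]
    refine sum_congr rfl fun p hp => ?_
    rw [← pow_succ', ← mem_antidiagonal.1 hp, pow_add]
    ring
  have hcancel : ∀ k, 1 - q ^ (k + 1) ≠ 0 := fun k =>
    (sub_pos.2 (pow_lt_one₀ hq0.le hq1 (by omega))).ne'
  have hne : ∀ k, qpoch q q k ≠ 0 := fun k => (qpoch_self_pos hq0 hq1 k).ne'
  rw [hsplit, Nat.sum_antidiagonal_succ', Nat.sum_antidiagonal_succ]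
  congr 1
  · simp only [pow_zero, sub_self, mul_zero, zero_mul, zero_add]
    refine sum_congr rfl fun p _ => ?_
    rw [qpoch_succ, ← pow_succ']
    field_simp [hne p.1, hne p.2, hcancel p.2]
  · simp only [pow_zero, sub_self, zero_mul, zero_add]
    refine sum_congr rfl fun p _ => ?_
    rw [qpoch_succ, ← pow_succ']
    field_simp [hne p.1, hne p.2, hcancel p.1]

/-- The finite `q`-binomial theorem. -/
lemma qbinomial_theorem {q : ℝ} (hq0 : 0 < q) (hq1 : q < 1) (n : ℕ) (z : ℝ) :
    ∑ p ∈ antidiagonal n, (-1) ^ p.1 * q ^ (p.1.choose 2) * z ^ p.1 /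
      (qpoch q q p.1 * qpoch q q p.2) = qpoch q z n / qpoch q q n := by
  induction n generalizing z with
  | zero => simp [qpoch_zero]
  | succ n ih =>
    have h := sum_antidiagonal_qpascal hq0 hq1 n fun i _ => (-1) ^ i * q ^ (i.choose 2) * z ^ i
    have e1 : ∑ p ∈ antidiagonal n, q ^ p.1 * ((-1) ^ p.1 * q ^ (p.1.choose 2) * z ^ p.1) /
        (qpoch q q p.1 * qpoch q q p.2) = qpoch q (z * q) n / qpoch q q n := by
      rw [← ih]
      refine sum_congr rfl fun p _ => ?_
      rw [mul_pow]; ring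
    have e2 : ∑ p ∈ antidiagonal n, (-1) ^ (p.1 + 1) * q ^ ((p.1 + 1).choose 2) * z ^ (p.1 + 1) /
        (qpoch q q p.1 * qpoch q q p.2) = -z * (qpoch q (z * q) n / qpoch q q n) := by
      rw [← ih, mul_sum]
      refine sum_congr rfl fun p _ => ?_
      rw [Nat.choose_succ_succ' p.1 1, Nat.choose_one_right, pow_add q p.1, mul_pow]; ring
    rw [e1, e2] at h
    have hn := (qpoch_self_pos hq0 hq1 n).ne'
    have hn1 := (qpoch_self_pos hq0 hq1 (n + 1)).ne'
    rw [qpoch_succ] at hn1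
    have hc := right_ne_zero_of_mul hn1
    rw [qpoch_succ' q z, qpoch_succ q q, ← mul_right_inj' hc, h]
    field_simp
    ring

/-- The expansion of `a ^ L` inverse to the finite `q`-binomial theorem. -/
lemma sum_antidiagonal_qpoch {q : ℝ} (hq0 : 0 < q) (hq1 : q < 1) (L : ℕ) (a : ℝ) :
    ∑ p ∈ antidiagonal L, (-1) ^ p.1 * q ^ (p.2.choose 2) * qpoch q a p.1 /
      (qpoch q q p.1 * qpoch q q p.2) = a ^ L * q ^ (L.choose 2) / qpoch q q L := by
  induction L generalizing a with
  | zero => simp [qpoch_zero]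
  | succ L ih =>
    have h := sum_antidiagonal_qpascal hq0 hq1 L fun i j =>
      (-1) ^ i * q ^ (j.choose 2) * qpoch q a i
    have e1 : ∑ p ∈ antidiagonal L, q ^ p.1 * ((-1) ^ p.1 * q ^ ((p.2 + 1).choose 2) *
        qpoch q a p.1) / (qpoch q q p.1 * qpoch q q p.2) =
        q ^ L * (a ^ L * q ^ (L.choose 2) / qpoch q q L) := by
      rw [← ih, mul_sum]
      refine sum_congr rfl fun p hp => ?_
      rw [Nat.choose_succ_succ' p.2 1, Nat.choose_one_right, pow_add q p.2,
        ← mem_antidiagonal.1 hp, pow_add q p.1]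
      ring
    have e2 : ∑ p ∈ antidiagonal L, (-1) ^ (p.1 + 1) * q ^ (p.2.choose 2) * qpoch q a (p.1 + 1) /
        (qpoch q q p.1 * qpoch q q p.2) =
        -(1 - a) * ((a * q) ^ L * q ^ (L.choose 2) / qpoch q q L) := by
      rw [← ih, mul_sum]
      refine sum_congr rfl fun p _ => ?_
      rw [qpoch_succ']; ring
    rw [e1, e2] at h
    have hn := (qpoch_self_pos hq0 hq1 L).ne'
    have hn1 := (qpoch_self_pos hq0 hq1 (L + 1)).ne'
    rw [qpoch_succ] at hn1
    have hc := right_ne_zero_of_mul hn1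
    rw [Nat.choose_succ_succ' L 1, Nat.choose_one_right, pow_add q L, qpoch_succ q q,
      ← mul_right_inj' hc, h, ← mul_div_assoc (1 - q * q ^ L), mul_comm (qpoch q q L),
      mul_div_mul_left _ _ hc]
    field_simp
    ring

end QPochhammer

section QuantumQKrawtchouk

open Polynomial Finset

/-- The polynomial `x ↦ (b x; q)_k`. -/
noncomputable def qpochPoly (q b : ℝ) (k : ℕ) : ℝ[X] := ∏ j ∈ range k, (C (-(b * q ^ j)) * X + C 1)

lemma eval_qpochPoly (q b : ℝ) (k : ℕ) (x : ℝ) : (qpochPoly q b k).eval x = qpoch q (b * x) k := by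
  rw [qpochPoly, qpoch, eval_prod]
  refine prod_congr rfl fun j _ => ?_
  simp only [eval_add, eval_mul, eval_C, eval_X]
  ring

lemma natDegree_qpochPoly {q b : ℝ} (hq : q ≠ 0) (hb : b ≠ 0) (k : ℕ) :
    (qpochPoly q b k).natDegree = k := by
  have hd : ∀ j, (C (-(b * q ^ j)) * X + C 1 : ℝ[X]).natDegree = 1 := fun j =>
    natDegree_linear (neg_ne_zero.2 (mul_ne_zero hb (pow_ne_zero _ hq)))
  rw [qpochPoly, natDegree_prod, sum_congr rfl fun j _ => hd j]
  · simp
  · intro j _ h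
    have := hd j
    rw [h, natDegree_zero] at this
    exact zero_ne_one this

/-- The quantum `q`-Krawtchouk polynomial with parameter `M = N - 1`, up to a nonzero factor. -/
noncomputable def krawtchoukPoly (q : ℝ) (M n : ℕ) (α : ℝ) : ℝ[X] :=
  ∑ k ∈ range (n + 1), C (qpoch q q (M - k) / (qpoch q q k * qpoch q q (n - k)) *
    (α * q ^ (M + 1)) ^ k) * qpochPoly q 1 k

/-- The orthogonality weight of the quantum `q`-Krawtchouk polynomials at the node `q^{-x}`. -/
noncomputable def krawtchoukWeight (q : ℝ) (M : ℕ) (α : ℝ) (x : ℕ) : ℝ :=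
  (-1) ^ (M - x) * qpoch q (α * q) (M - x) * q ^ (x.choose 2) / (qpoch q q x * qpoch q q (M - x))

lemma natDegree_krawtchoukPoly {q : ℝ} (hq0 : 0 < q) (hq1 : q < 1) {M n : ℕ} {α : ℝ} (hα : 0 < α) :
    (krawtchoukPoly q M n α).natDegree = n := by
  have hterm : ∀ k, (C (qpoch q q (M - k) / (qpoch q q k * qpoch q q (n - k)) *
      (α * q ^ (M + 1)) ^ k) * qpochPoly q 1 k).natDegree = k := by
    intro k
    rw [natDegree_C_mul, natDegree_qpochPoly hq0.ne' one_ne_zero]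
    have h1 := qpoch_self_pos hq0 hq1 k
    have h2 := qpoch_self_pos hq0 hq1 (M - k)
    have h3 := qpoch_self_pos hq0 hq1 (n - k)
    positivity
  rw [krawtchoukPoly, sum_range_succ]
  rcases Nat.eq_zero_or_pos n with rfl | hn
  · simpa using hterm 0
  rw [natDegree_add_eq_right_of_natDegree_lt, hterm]
  rw [hterm]
  have hle := natDegree_sum_le_of_forall_le (n := n - 1) (range n)
    (fun k => C (qpoch q q (M - k) / (qpoch q q k * qpoch q q (n - k)) *
      (α * q ^ (M + 1)) ^ k) * qpochPoly q 1 k)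
    (fun k hk => by rw [hterm]; have := mem_range.1 hk; omega)
  omega

lemma krawtchoukPoly_ne_zero {q : ℝ} (hq0 : 0 < q) (hq1 : q < 1) {M n : ℕ} {α : ℝ} (hα : 0 < α)
    (hn : 1 ≤ n) : krawtchoukPoly q M n α ≠ 0 := by
  intro h
  have := natDegree_krawtchoukPoly hq0 hq1 (M := M) (n := n) hα
  rw [h, natDegree_zero] at this
  omega

lemma neg_one_pow_mul_qpoch (q a : ℝ) (k : ℕ) :
    (-1) ^ k * qpoch q a k = ∏ j ∈ range k, (a * q ^ j - 1) := by
  rw [qpoch, ← card_range k, ← prod_const, card_range, ← prod_mul_distrib]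
  exact prod_congr rfl fun j _ => by ring

lemma one_lt_mul_pow {q : ℝ} (hq0 : 0 < q) (hq1 : q < 1) {M j : ℕ} {α : ℝ} (hα : 1 < α * q ^ M)
    (hj : j + 1 ≤ M) : 1 < α * q * q ^ j := by
  have hα0 : 0 < α := by
    by_contra! h
    have := mul_nonpos_of_nonpos_of_nonneg h (pow_pos hq0 M).le
    linarith
  have h := mul_le_mul_of_nonneg_left (pow_le_pow_of_le_one hq0.le hq1.le hj) hα0.le
  rw [mul_assoc, ← pow_succ']
  linarith

lemma krawtchoukWeight_pos {q : ℝ} (hq0 : 0 < q) (hq1 : q < 1) {M : ℕ} {α : ℝ}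
    (hα : 1 < α * q ^ M) (x : ℕ) : 0 < krawtchoukWeight q M α x := by
  rw [krawtchoukWeight, neg_one_pow_mul_qpoch]
  have h1 := qpoch_self_pos hq0 hq1 x
  have h2 := qpoch_self_pos hq0 hq1 (M - x)
  have h3 : 0 < ∏ j ∈ range (M - x), (α * q * q ^ j - 1) := prod_pos fun j hj =>
    sub_pos.2 (one_lt_mul_pow hq0 hq1 hα (by have := mem_range.1 hj; omega))
  positivity

lemma krawtchoukWeight_ratio_lt {q : ℝ} (hq0 : 0 < q) (hq1 : q < 1) {M : ℕ} {α β : ℝ}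
    (hα : 1 < α * q ^ M) (hαβ : α < β) {x y : ℕ} (hxy : x < y) (hy : y ≤ M) :
    krawtchoukWeight q M α x / krawtchoukWeight q M β x <
      krawtchoukWeight q M α y / krawtchoukWeight q M β y := by
  have hβ : 1 < β * q ^ M := hα.trans (mul_lt_mul_of_pos_right hαβ (pow_pos hq0 M))
  have hpos : ∀ γ, 1 < γ * q ^ M → ∀ j, j + 1 ≤ M → 0 < γ * q * q ^ j - 1 := fun γ hγ j hj =>
    sub_pos.2 (one_lt_mul_pow hq0 hq1 hγ hj)
  have hratio : ∀ z, krawtchoukWeight q M α z / krawtchoukWeight q M β z =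
      ∏ j ∈ range (M - z), ((α * q * q ^ j - 1) / (β * q * q ^ j - 1)) := by
    intro z
    rw [krawtchoukWeight, krawtchoukWeight, neg_one_pow_mul_qpoch, neg_one_pow_mul_qpoch,
      prod_div_distrib]
    have h1 := (qpoch_self_pos hq0 hq1 z).ne'
    have h2 := (qpoch_self_pos hq0 hq1 (M - z)).ne'
    have h3 : q ^ z.choose 2 ≠ 0 := pow_ne_zero _ hq0.ne'
    rw [div_div_div_cancel_right₀ (mul_ne_zero h1 h2), mul_div_mul_right _ _ h3]
  rw [hratio, hratio, show M - x = (M - y) + (y - x) by omega, prod_range_add]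
  refine mul_lt_of_lt_one_right (prod_pos fun j hj => ?_) ?_
  · have := mem_range.1 hj
    exact div_pos (hpos α hα j (by omega)) (hpos β hβ j (by omega))
  · have hlt : ∀ j ∈ range (y - x), (α * q * q ^ (M - y + j) - 1) / (β * q * q ^ (M - y + j) - 1) < 1 := by
      intro j hj
      have := mem_range.1 hj
      rw [div_lt_one (hpos β hβ _ (by omega))]
      gcongr
    refine (prod_lt_prod_of_nonempty (g := fun _ => (1 : ℝ)) (fun j hj => ?_) hlt
      ⟨0, by simp; omega⟩).trans_eq prod_const_one
    have := mem_range.1 hj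
    exact div_pos (hpos α hα _ (by omega)) (hpos β hβ _ (by omega))

lemma two_mul_choose_two_add (k : ℕ) : 2 * k.choose 2 + k = k * k := by
  induction k with
  | zero => rfl
  | succ k ih =>
    rw [Nat.choose_succ_succ' k 1, Nat.choose_one_right]
    linarith

lemma add_choose_two (k y : ℕ) : (k + y).choose 2 = k.choose 2 + y.choose 2 + k * y := by
  have h1 := two_mul_choose_two_add k
  have h2 := two_mul_choose_two_add y
  have h3 := two_mul_choose_two_add (k + y)
  nlinarith

/-- The moments of the weight against products of the two families of `q`-shifted factorials. -/
lemma sum_krawtchoukWeight_mul {q : ℝ} (hq0 : 0 < q) (hq1 : q < 1) (k L m : ℕ) (α : ℝ) :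
    ∑ x ∈ range (k + L + 1), krawtchoukWeight q (k + L) α x * (qpoch q (q⁻¹ ^ x) k *
      qpoch q (α * q ^ (k + L + 1) * q⁻¹ ^ x) m) =
    (-1) ^ k * q⁻¹ ^ k * qpoch q (α * q) m *
      ((α * q ^ (m + 1)) ^ L * q ^ (L.choose 2) / qpoch q q L) := by
  have hne : ∀ k, qpoch q q k ≠ 0 := fun k => (qpoch_self_pos hq0 hq1 k).ne'
  have hfirst : ∑ x ∈ range k, krawtchoukWeight q (k + L) α x * (qpoch q (q⁻¹ ^ x) k *
      qpoch q (α * q ^ (k + L + 1) * q⁻¹ ^ x) m) = 0 :=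
    sum_eq_zero fun x hx => by
      rw [qpoch_inv_pow_eq_zero hq0.ne' (mem_range.1 hx), zero_mul, mul_zero]
  rw [show range (k + L + 1) = range (k + (L + 1)) from rfl, sum_range_add, hfirst, zero_add, ← sum_antidiagonal_qpoch hq0 hq1,
    Nat.sum_antidiagonal_swap.symm, mul_sum,
    Nat.sum_antidiagonal_eq_sum_range_succ_mk]
  refine sum_congr rfl fun y hy => ?_
  obtain ⟨j, rfl⟩ := Nat.exists_eq_add_of_le (Nat.lt_succ_iff.1 (mem_range.1 hy))
  have hq := hq0.ne'
  have h1 := qpoch_inv_pow_mul hq k y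
  have e1 : α * q ^ (k + (y + j) + 1) * q⁻¹ ^ (k + y) = α * q * q ^ j := by
    rw [show k + (y + j) + 1 = (k + y) + (j + 1) by ring, pow_add q (k + y), inv_pow]
    field_simp
    ring
  have e2 : qpoch q (α * q) j * qpoch q (α * q * q ^ j) m =
      qpoch q (α * q) m * qpoch q (α * q ^ (m + 1)) j := by
    rw [← qpoch_add, add_comm, qpoch_add, pow_succ']; ring_nf
  have e3 : q ^ (k + y).choose 2 * (q ^ (k.choose 2) * q⁻¹ ^ ((k + y) * k)) =
      q⁻¹ ^ k * q ^ (y.choose 2) := by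
    have hk := two_mul_choose_two_add k
    rw [add_choose_two, show (k + y) * k = (2 * k.choose 2 + k * y) + k by rw [add_right_comm, hk]; ring,
      pow_add q⁻¹, inv_pow q (2 * _ + _)]
    have : q ^ (2 * k.choose 2 + k * y) ≠ 0 := pow_ne_zero _ hq
    rw [← mul_right_inj' this]
    field_simp
    ring
  simp only [Prod.fst_swap, Prod.snd_swap]
  rw [krawtchoukWeight, e1, show k + (y + j) - (k + y) = j by omega, Nat.add_sub_cancel_left]
  rw [← eq_div_iff (hne y)] at h1
  rw [h1]
  generalize q⁻¹ = r at *
  have h2 := hne y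
  have h3 := hne j
  have h4 := hne (k + y)
  calc _ = (-1) ^ j * (-1) ^ k * (qpoch q (α * q) j * qpoch q (α * q * q ^ j) m) *
        (q ^ (k + y).choose 2 * (q ^ (k.choose 2) * r ^ ((k + y) * k))) /
        (qpoch q q y * qpoch q q j) := by field_simp
    _ = _ := by rw [e2, e3]; field_simp

lemma krawtchoukPoly_orthogonal_qpochPoly {q : ℝ} (hq0 : 0 < q) (hq1 : q < 1) {M n m : ℕ}
    (hnM : n ≤ M) (hm : m < n) (α : ℝ) :
    discreteIntegral M (fun x => q⁻¹ ^ x) (krawtchoukWeight q M α)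
      (krawtchoukPoly q M n α * qpochPoly q (α * q ^ (M + 1)) m) = 0 := by
  have hq := hq0.ne'
  have hne : ∀ k, qpoch q q k ≠ 0 := fun k => (qpoch_self_pos hq0 hq1 k).ne'
  rw [krawtchoukPoly, sum_mul, map_sum]
  have hterm : ∀ k ∈ range (n + 1), discreteIntegral M (fun x => q⁻¹ ^ x) (krawtchoukWeight q M α)
      (C (qpoch q q (M - k) / (qpoch q q k * qpoch q q (n - k)) * (α * q ^ (M + 1)) ^ k) *
        qpochPoly q 1 k * qpochPoly q (α * q ^ (M + 1)) m) =
      (qpoch q (α * q) m * α ^ M * q ^ ((m + 1) * M) * q ^ (M.choose 2)) *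
        ((-1) ^ k * q ^ (k.choose 2) * (q⁻¹ ^ m) ^ k / (qpoch q q k * qpoch q q (n - k))) := by
    intro k hk
    obtain ⟨L, rfl⟩ := Nat.exists_eq_add_of_le
      (show k ≤ M by have := mem_range.1 hk; omega)
    rw [mul_assoc, ← smul_eq_C_mul, map_smul, smul_eq_mul, discreteIntegral_apply]
    simp only [eval_mul, eval_qpochPoly, one_mul]
    rw [sum_krawtchoukWeight_mul hq0 hq1, Nat.add_sub_cancel_left]
    have e : (α * q ^ (k + L + 1)) ^ k * q⁻¹ ^ k * ((α * q ^ (m + 1)) ^ L * q ^ (L.choose 2)) =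
        α ^ (k + L) * q ^ ((m + 1) * (k + L)) * q ^ ((k + L).choose 2) *
          (q ^ (k.choose 2) * (q⁻¹ ^ m) ^ k) := by
      have e1 : (α * q ^ (k + L + 1)) ^ k * q⁻¹ ^ k = α ^ k * q ^ (k * k + k * L) := by
        rw [← mul_pow, pow_succ, ← mul_assoc, mul_inv_cancel_right₀ hq, mul_pow, ← pow_mul]
        ring_nf
      have e2 : q ^ ((m + 1) * (k + L)) * (q⁻¹ ^ m) ^ k = q ^ (k + (m + 1) * L) := by
        rw [show (m + 1) * (k + L) = (k + (m + 1) * L) + m * k by ring, pow_add, ← pow_mul,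
          mul_assoc, ← mul_pow, mul_inv_cancel₀ hq, one_pow, mul_one]
      rw [e1, add_choose_two, ← two_mul_choose_two_add]
      linear_combination (-(α ^ (k + L) * q ^ (k.choose 2 + L.choose 2 + k * L) *
        q ^ (k.choose 2))) * e2
    have h1 := hne L
    have h2 := hne k
    have h3 := hne (n - k)
    calc _ = (-1) ^ k * qpoch q (α * q) m * ((α * q ^ (k + L + 1)) ^ k * q⁻¹ ^ k *
          ((α * q ^ (m + 1)) ^ L * q ^ (L.choose 2))) / (qpoch q q k * qpoch q q (n - k)) := by
          generalize q⁻¹ = r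
          field_simp
      _ = _ := by rw [e]; ring
  rw [sum_congr rfl hterm, ← mul_sum,
    ← Nat.sum_antidiagonal_eq_sum_range_succ (fun i j => (-1) ^ i * q ^ (i.choose 2) *
      (q⁻¹ ^ m) ^ i / (qpoch q q i * qpoch q q j)), qbinomial_theorem hq0 hq1,
    qpoch_inv_pow_eq_zero hq hm, zero_div, mul_zero]

lemma krawtchoukPoly_orthogonal {q : ℝ} (hq0 : 0 < q) (hq1 : q < 1) {M n : ℕ}
    (hnM : n ≤ M) {α : ℝ} (hα : 0 < α) (g : ℝ[X]) (hg : g.natDegree < n) :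
    discreteIntegral M (fun x => q⁻¹ ^ x) (krawtchoukWeight q M α)
      (krawtchoukPoly q M n α * g) = 0 := by
  have hb : α * q ^ (M + 1) ≠ 0 := (by positivity : 0 < α * q ^ (M + 1)).ne'
  suffices h : ∀ d ≤ n, ∀ g : ℝ[X], g.degree < d →
      discreteIntegral M (fun x => q⁻¹ ^ x) (krawtchoukWeight q M α)
        (krawtchoukPoly q M n α * g) = 0 by
    exact h n le_rfl g (degree_le_natDegree.trans_lt (by exact_mod_cast hg))
  intro d
  induction d with
  | zero =>
    intro _ g hg
    have : g = 0 := by simpa using hg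
    simp [this]
  | succ d ih =>
    intro hd g hg
    set φ := qpochPoly q (α * q ^ (M + 1)) d with hφ
    have hφd : φ.natDegree = d := natDegree_qpochPoly hq0.ne' hb d
    have hφ0 : φ.leadingCoeff ≠ 0 := by
      rw [leadingCoeff_ne_zero, hφ, qpochPoly, prod_ne_zero_iff]
      intro j _ h
      simpa using congrArg (coeff · 0) h
    have hdeg : (g - C (g.coeff d / φ.leadingCoeff) * φ).degree < d := by
      rw [degree_lt_iff_coeff_zero]
      intro i hi
      rw [coeff_sub, coeff_C_mul]
      rcases hi.eq_or_lt with rfl | hi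
      · rw [leadingCoeff, hφd] at hφ0 ⊢
        field_simp
        ring
      · rw [coeff_eq_zero_of_natDegree_lt (hφd.trans_lt hi),
          (degree_lt_iff_coeff_zero g (d + 1)).1 (by exact_mod_cast hg) i hi]
        simp
    have hg' : krawtchoukPoly q M n α * g =
        krawtchoukPoly q M n α * (g - C (g.coeff d / φ.leadingCoeff) * φ) +
        (g.coeff d / φ.leadingCoeff) • (krawtchoukPoly q M n α * φ) := by
      rw [smul_eq_C_mul]; ring
    rw [hg', map_add, map_smul, ih (by omega) _ hdeg,
      krawtchoukPoly_orthogonal_qpochPoly hq0 hq1 hnM (by omega), smul_zero, add_zero]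

lemma quantumQKrawtchoukPoly_eq_zero_iff {q : ℝ} (hq0 : 0 < q) (hq1 : q < 1) {M n : ℕ}
    (hnM : n ≤ M) {α : ℝ} (hα : 0 < α) (x : ℝ) :
    quantumQKrawtchoukPoly q (M + 1) n α x = 0 ↔ (krawtchoukPoly q M n α).eval x = 0 := by
  have hq := hq0.ne'
  have hne : ∀ k, qpoch q q k ≠ 0 := fun k => (qpoch_self_pos hq0 hq1 k).ne'
  have hpre : qpoch q (q ^ (-((M + 1 : ℕ) : ℤ))) n / (α ^ n * q ^ (n ^ 2)) ≠ 0 := by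
    refine div_ne_zero ?_ (by positivity)
    obtain ⟨y, hy⟩ := Nat.exists_eq_add_of_le (show n ≤ M + 1 by omega)
    rw [zpow_neg, zpow_natCast, ← inv_pow, hy]
    refine left_ne_zero_of_mul (b := qpoch q q y) ?_
    rw [qpoch_inv_pow_mul hq]
    have := hne (n + y)
    have := inv_ne_zero hq
    simp [*]
  have hterm : ∀ k ∈ range (n + 1), qpoch q (q ^ (-(n : ℤ))) k * qpoch q x k /
        (qpoch q (q ^ ((1 : ℤ) - ((M + 1 : ℕ) : ℤ))) k * qpoch q q k) * (α * q ^ (n + 1)) ^ k =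
      qpoch q q n / qpoch q q M * (qpoch q q (M - k) / (qpoch q q k * qpoch q q (n - k)) *
        (α * q ^ (M + 1)) ^ k * qpoch q x k) := by
    intro k hk
    obtain ⟨y, rfl⟩ := Nat.exists_eq_add_of_le (show k ≤ n by have := mem_range.1 hk; omega)
    obtain ⟨d, rfl⟩ := Nat.exists_eq_add_of_le hnM
    have h1 := qpoch_inv_pow_mul hq k y
    have h2 := qpoch_inv_pow_mul hq k (y + d)
    rw [← eq_div_iff (hne _)] at h1 h2
    rw [show (1 : ℤ) - ((k + y + d + 1 : ℕ) : ℤ) = -((k + (y + d) : ℕ) : ℤ) by push_cast; ring,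
      zpow_neg, zpow_natCast, zpow_neg, zpow_natCast, ← inv_pow, ← inv_pow, h1, h2,
      show k + y + d - k = y + d by omega, Nat.add_sub_cancel_left, ← add_assoc k y d]
    have e : q⁻¹ ^ ((k + y) * k) * (α * q ^ (k + y + 1)) ^ k =
        q⁻¹ ^ ((k + y + d) * k) * (α * q ^ (k + y + d + 1)) ^ k := by
      rw [pow_mul, pow_mul q⁻¹, ← mul_pow, ← mul_pow, pow_succ, pow_succ q (k + y + d), inv_pow,
        inv_pow]
      field_simp
    have h3 := hne k
    have h4 := hne y
    have h5 := hne (y + d)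
    have h6 := hne (k + y)
    have h7 := hne (k + y + d)
    have h8 := pow_ne_zero (k.choose 2) hq
    have h9 := pow_ne_zero ((k + y + d) * k) (inv_ne_zero hq)
    calc _ = (-1) ^ k * q ^ k.choose 2 * qpoch q q (k + y) / qpoch q q y * qpoch q x k /
          ((-1) ^ k * q ^ k.choose 2 * q⁻¹ ^ ((k + y + d) * k) * qpoch q q (k + y + d) /
            qpoch q q (y + d) * qpoch q q k) *
          (q⁻¹ ^ ((k + y) * k) * (α * q ^ (k + y + 1)) ^ k) := by ring
      _ = _ := by
        rw [e]
        generalize q⁻¹ = r at *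
        field_simp
  rw [quantumQKrawtchoukPoly, mul_eq_zero_iff_left hpre, sum_congr rfl hterm, ← mul_sum,
    mul_eq_zero_iff_left (div_ne_zero (hne n) (hne M)), krawtchoukPoly, eval_finsetSum]
  simp only [eval_mul, eval_C, eval_qpochPoly, one_mul]

end QuantumQKrawtchouk

/-- zeros of quantum q-Krawtchouk polynomials: monotonicity in `α`. -/
theorem stmt_13 (q : ℝ) (hq0 : 0 < q) (hq1 : q < 1) (N n : ℕ) (hN : 2 ≤ N) (hn : 1 ≤ n)
    (hnN : n ≤ N - 1) :
    ∃ x : ℝ → Fin n → ℝ,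
      (∀ α : ℝ, q ^ ((1 : ℤ) - (N : ℤ)) < α →
        StrictMono (x α) ∧
        (∀ j, quantumQKrawtchoukPoly q N n α (x α j) = 0) ∧
        (∀ y : ℝ, quantumQKrawtchoukPoly q N n α y = 0 → ∃ j, y = x α j)) ∧
      (∀ j, StrictAntiOn (fun α => x α j) (Set.Ioi (q ^ ((1 : ℤ) - (N : ℤ))))) := by
  obtain ⟨M, rfl⟩ : ∃ M, N = M + 1 := ⟨N - 1, by omega⟩
  have hnM' : n ≤ M := by omega
  have hnode : StrictMono fun x : ℕ => q⁻¹ ^ x := pow_right_strictMono₀ ((one_lt_inv₀ hq0).2 hq1)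
  have hparam : ∀ α, q ^ ((1 : ℤ) - ((M + 1 : ℕ) : ℤ)) < α → 0 < α ∧ 1 < α * q ^ M := by
    intro α hα
    rw [show (1 : ℤ) - ((M + 1 : ℕ) : ℤ) = -(M : ℤ) by push_cast; ring, zpow_neg,
      zpow_natCast] at hα
    have hM := pow_pos hq0 M
    exact ⟨(inv_pos.2 hM).trans hα, (inv_lt_iff_one_lt_mul₀ hM).1 hα⟩
  have hex : ∀ α, ∃ x : Fin n → ℝ, q ^ ((1 : ℤ) - ((M + 1 : ℕ) : ℤ)) < α → StrictMono x ∧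
      ∀ y, (krawtchoukPoly q M n α).eval y = 0 ↔ ∃ j, y = x j := by
    intro α
    by_cases hα : q ^ ((1 : ℤ) - ((M + 1 : ℕ) : ℤ)) < α
    · obtain ⟨hα0, hα1⟩ := hparam α hα
      obtain ⟨x, hx⟩ := exists_strictMono_zeros_of_orthogonal hnode
        (fun y _ => krawtchoukWeight_pos hq0 hq1 hα1 y)
        (krawtchoukPoly_ne_zero hq0 hq1 hα0 hn) (natDegree_krawtchoukPoly hq0 hq1 hα0) hnM'
        (krawtchoukPoly_orthogonal hq0 hq1 hnM' hα0)
      exact ⟨x, fun _ => hx⟩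
    · exact ⟨fun _ => 0, fun h => absurd h hα⟩
  choose x hx using hex
  refine ⟨x, fun α hα => ⟨(hx α hα).1, fun j => ?_, fun y hy => ?_⟩, fun j α hα β hβ hαβ => ?_⟩
  · rw [quantumQKrawtchoukPoly_eq_zero_iff hq0 hq1 hnM' (hparam α hα).1, (hx α hα).2]
    exact ⟨j, rfl⟩
  · rwa [quantumQKrawtchoukPoly_eq_zero_iff hq0 hq1 hnM' (hparam α hα).1, (hx α hα).2] at hy
  · obtain ⟨hα0, hα1⟩ := hparam α hα
    obtain ⟨hβ0, hβ1⟩ := hparam β hβ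
    exact zeros_lt_of_weight_ratio_strictMono hnode
      (fun y _ => krawtchoukWeight_pos hq0 hq1 hα1 y)
      (fun y _ => krawtchoukWeight_pos hq0 hq1 hβ1 y)
      (fun _ _ hyz hz => krawtchoukWeight_ratio_lt hq0 hq1 hα1 hαβ hyz hz) hnM'
      (krawtchoukPoly_ne_zero hq0 hq1 hα0 hn) (natDegree_krawtchoukPoly hq0 hq1 hα0)
      (krawtchoukPoly_ne_zero hq0 hq1 hβ0 hn) (natDegree_krawtchoukPoly hq0 hq1 hβ0)
      (krawtchoukPoly_orthogonal hq0 hq1 hnM' hα0) (krawtchoukPoly_orthogonal hq0 hq1 hnM' hβ0)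
      (hx α hα).1 (hx β hβ).1 (fun i => ((hx α hα).2 _).2 ⟨i, rfl⟩)
      (fun i => ((hx β hβ).2 _).2 ⟨i, rfl⟩) j
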